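/- arXiv:0810.5205 — 4 statements merged into one kernel-verified Lean document; each statement's English description precedes it below -/
import Mathlib

section
/- Let n ≥ 2. If α′ ∈ A_n is obtained from α ∈ A_n by applying one elementary operation E_s or E_c at a positive cell of α (i.e., at an odd index), then α′ < α in the lexical order. -/
/-!
Common definitions: α-sequences, the lexical order, elementary operations,
lexical sequences, harmonics, star products, etc.
-/

/-- The sign-alternating sequence `Al(τ)` associated to an α-sequence `τ`
(0-indexed: entry `i` of `Al τ` is `(-1)^i * τ_{i+1}`, and `0` beyond the length). -/
def Al (τ : List ℕ) (i : ℕ) : ℤ := (-1 : ℤ) ^ i * (τ.getD i 0 : ℤ)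

/-- The (strict) lexical order: `τ < τ'` iff the first nonzero entry of
`Al τ - Al τ'` is negative. -/
def lexLt (τ τ' : List ℕ) : Prop :=
  ∃ i, (∀ j < i, Al τ j = Al τ' j) ∧ Al τ i < Al τ' i

/-- An α-sequence: a nonempty finite sequence of positive integers. -/
def IsAlphaSeq (α : List ℕ) : Prop := α ≠ [] ∧ ∀ x ∈ α, 0 < x

/-- `Aset n` is the set `A_n` of α-sequences of degree `n`. -/
def Aset (n : ℕ) : Set (List ℕ) := {α | IsAlphaSeq α ∧ α.sum = n}

/-- Splitting operation `E_s` at the (1-indexed) cell `i`: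
`(α₁,…,α_{i-1}, α_i - 1, 1, α_{i+1},…,α_k)`. -/
def applyEs (α : List ℕ) (i : ℕ) : List ℕ :=
  α.take (i - 1) ++ [α.getD (i - 1) 0 - 1, 1] ++ α.drop i

/-- `E_s` is applicable at cell `i` iff `1 ≤ i ≤ l(α)` and `α_i > 1`. -/
def EsApplicable (α : List ℕ) (i : ℕ) : Prop :=
  1 ≤ i ∧ i ≤ α.length ∧ 1 < α.getD (i - 1) 0

/-- Conjugation operation `E_c` at the (1-indexed) cell `i`:
`(α₁,…,α_{i-2}, α_{i-1} + 1, α_{i+1},…,α_k)`. -/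
def applyEc (α : List ℕ) (i : ℕ) : List ℕ :=
  α.take (i - 2) ++ [α.getD (i - 2) 0 + 1] ++ α.drop i

/-- `E_c` is applicable at cell `i` iff `2 ≤ i ≤ l(α)` and `α_i = 1`. -/
def EcApplicable (α : List ℕ) (i : ℕ) : Prop :=
  2 ≤ i ∧ i ≤ α.length ∧ α.getD (i - 1) 0 = 1

/-- `α'` is obtained from `α` by applying one elementary operation (`E_s` or `E_c`)
at the (1-indexed) cell `i`. -/
def ElemOpAt (α : List ℕ) (i : ℕ) (α' : List ℕ) : Prop :=
  (EsApplicable α i ∧ α' = applyEs α i) ∨ (EcApplicable α i ∧ α' = applyEc α i)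

/-- `a < b` and `a`, `b` are adjacent in `S`: no element of `S` lies strictly between. -/
def AdjLtIn (S : Set (List ℕ)) (a b : List ℕ) : Prop :=
  lexLt a b ∧ ∀ γ ∈ S, ¬ (lexLt a γ ∧ lexLt γ b)

/-- An α-sequence is lexical iff it strictly exceeds all of its proper right sequences. -/
def IsLexical (α : List ℕ) : Prop :=
  IsAlphaSeq α ∧ ∀ i, 2 ≤ i → i ≤ α.length → lexLt (α.drop (i - 1)) α

/-- `Lset n` is the set `L_n` of lexical sequences `α` with `1 + D(α) = n`. -/
def Lset (n : ℕ) : Set (List ℕ) := {α | IsLexical α ∧ 1 + α.sum = n}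

/-- Add `1` to the last entry of a list. -/
def bumpLast (α : List ℕ) : List ℕ := α.dropLast ++ [α.getD (α.length - 1) 0 + 1]

/-- `α_e`: the even-length modification of `α`. -/
def seqE (α : List ℕ) : List ℕ := if Even α.length then bumpLast α else α ++ [1]

/-- `α_o`: the odd-length modification of `α`. -/
def seqO (α : List ℕ) : List ℕ := if Even α.length then α ++ [1] else bumpLast α

/-- The `j`-th harmonicSeq: `h_0(α) = α` and `h_j(α) = (h_{j-1}(α))_o h_{j-1}(α)`. -/
def harmonicSeq : ℕ → List ℕ → List ℕ
  | 0, α => α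
  | j + 1, α => seqO (harmonicSeq j α) ++ harmonicSeq j α

/-- A sequence is fundamental iff it is not a harmonicSeq `h_j(β)`, `j ≥ 1`,
of any α-sequence `β`. -/
def IsFundamental (α : List ℕ) : Prop :=
  ∀ β : List ℕ, IsAlphaSeq β → ∀ j, 1 ≤ j → α ≠ harmonicSeq j β

/-- `α^q`: the `q`-fold concatenation of `α` with itself. -/
def nrep (α : List ℕ) (q : ℕ) : List ℕ := (List.replicate q α).flatten

/-- The star product
`α ⋆ β = α_o (α_e)^{β₁-1} α_o (α_e)^{β₂-1} ⋯ α_o (α_e)^{β_k-1} α`. -/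
def starProd (α β : List ℕ) : List ℕ :=
  (β.map (fun b => seqO α ++ nrep (seqE α) (b - 1))).flatten ++ α

/-- `α ∧ β`: the longest common left factor, ended by the minimum of the
first differing entries. -/
def wedge : List ℕ → List ℕ → List ℕ
  | [], _ => []
  | _, [] => []
  | a :: as, b :: bs => if a = b then a :: wedge as bs else [min a b]

/-- `a` is the least element of `S` in the lexical order. -/
def LeastIn (S : Set (List ℕ)) (a : List ℕ) : Prop :=
  a ∈ S ∧ ∀ b ∈ S, b ≠ a → lexLt a b

/-- `a` is the greatest element of `S` in the lexical order. -/
def GreatestIn (S : Set (List ℕ)) (a : List ℕ) : Prop :=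
  a ∈ S ∧ ∀ b ∈ S, b ≠ a → lexLt b a

/-- `i` is an even (1-indexed) cell of `α` at which the applicable elementary
operation yields a lexical sequence. -/
def GoodEvenIndex (α : List ℕ) (i : ℕ) : Prop :=
  Even i ∧ ∃ α', ElemOpAt α i α' ∧ IsLexical α'

/-- `i` is an odd (1-indexed) cell of `α` at which the applicable elementary
operation yields a lexical sequence. -/
def GoodOddIndex (α : List ℕ) (i : ℕ) : Prop :=
  Odd i ∧ ∃ α', ElemOpAt α i α' ∧ IsLexical α'

/-- The successor operation: apply whichever of `E_s`, `E_c` is applicable at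
the largest even (1-indexed) index `≤ l(α)`, i.e. on the tail of the longest
left sequence of even length. -/
def succOp (α : List ℕ) : List ℕ :=
  let i := if Even α.length then α.length else α.length - 1
  if 1 < α.getD (i - 1) 0 then applyEs α i else applyEc α i

/-- Keeping the first `k` entries of `α` and putting next an entry of smaller signed value
gives a smaller sequence, whatever follows. -/
theorem lexLt_take_append_cons {α : List ℕ} {k a : ℕ} (l : List ℕ) (hk : k ≤ α.length)
    (h : (-1 : ℤ) ^ k * (a : ℤ) < (-1 : ℤ) ^ k * (α.getD k 0 : ℤ)) :
    lexLt (α.take k ++ a :: l) α := by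
  refine ⟨k, fun j hj => ?_, ?_⟩
  · simp [Al, List.getElem?_append, hj, lt_of_lt_of_le hj hk]
  · simpa [Al, List.getElem?_append, hk] using h

/-- an elementary operation at a positive (odd 1-indexed) cell
produces a lexical-order predecessor. -/
theorem stmt_2 (n : ℕ) (hn : 2 ≤ n) (α α' : List ℕ)
    (hα : α ∈ Aset n) (hα' : α' ∈ Aset n)
    (i : ℕ) (hi : Odd i) (hop : ElemOpAt α i α') :
    lexLt α' α := by
  rcases hop with ⟨⟨h1, hlen, hlt⟩, rfl⟩ | ⟨⟨h2, hlen, -⟩, rfl⟩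
  · have heven : Even (i - 1) := by grind
    have key := lexLt_take_append_cons (α := α) (k := i - 1) (a := α.getD (i - 1) 0 - 1)
      (1 :: α.drop i) (by omega) (by rw [heven.neg_one_pow]; omega)
    simpa only [applyEs, List.append_assoc, List.cons_append, List.nil_append] using key
  · have hodd : Odd (i - 2) := by grind
    have key := lexLt_take_append_cons (α := α) (k := i - 2) (a := α.getD (i - 2) 0 + 1)
      (α.drop i) (by omega) (by rw [hodd.neg_one_pow]; omega)
    simpa only [applyEc, List.append_assoc, List.cons_append, List.nil_append] using key
end

section
/- Let n ≥ 2 and let α ∈ A_n, and let i be the largest odd index ≤ l(α). Assume an elementary operation is applicable at cell i (i.e., α_i > 1, or α_i = 1 and i ≥ 2), and let α′ be obtained from α by applying one elementary operation on the tail of the longest left sequence of odd length of α, i.e., at cell i. Then α′ ∈ A_n and α′ is adjacent to α in A_n with α′ < α (α′ is the immediate predecessor of α in A_n). -/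
theorem Al_cons_zero (a : ℕ) (s : List ℕ) : Al (a :: s) 0 = a := by simp [Al]

theorem Al_cons_succ (a : ℕ) (s : List ℕ) (i : ℕ) : Al (a :: s) (i + 1) = -Al s i := by
  simp [Al, pow_succ]

theorem lexLt_cons_cons (a b : ℕ) (s t : List ℕ) :
    lexLt (a :: s) (b :: t) ↔ a < b ∨ a = b ∧ lexLt t s := by
  constructor
  · rintro ⟨_ | i, hj, h⟩
    · left
      simpa [Al_cons_zero] using h
    · right
      refine ⟨by simpa [Al_cons_zero] using hj 0 (by omega), i, fun j hji => ?_, ?_⟩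
      · have := hj (j + 1) (by omega)
        rw [Al_cons_succ, Al_cons_succ] at this
        omega
      · rw [Al_cons_succ, Al_cons_succ] at h
        omega
  · rintro (h | ⟨rfl, i, hj, h⟩)
    · exact ⟨0, by simp, by simpa [Al_cons_zero] using h⟩
    · refine ⟨i + 1, ?_, ?_⟩
      · rintro (_ | j) hji
        · simp [Al_cons_zero]
        · rw [Al_cons_succ, Al_cons_succ, hj j (by omega)]
      · rw [Al_cons_succ, Al_cons_succ]
        omega

theorem not_lexLt_self (s : List ℕ) : ¬ lexLt s s := fun ⟨_, _, h⟩ => lt_irrefl _ h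

/-- The finite sequences of positive integers of sum `m`, including the empty one. -/
def posSeqs (m : ℕ) : Set (List ℕ) := {γ | (∀ x ∈ γ, 0 < x) ∧ γ.sum = m}

theorem AdjLtIn.cons {m : ℕ} {s t : List ℕ} (h : AdjLtIn (posSeqs m) s t) {x : ℕ}
    (hx : 0 < x) : AdjLtIn (posSeqs (x + m)) (x :: t) (x :: s) := by
  refine ⟨(lexLt_cons_cons ..).2 (Or.inr ⟨rfl, h.1⟩), ?_⟩
  rintro (_ | ⟨y, γ⟩) ⟨hpos, hsum⟩ ⟨h₁, h₂⟩
  · simp at hsum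
    omega
  · rw [lexLt_cons_cons] at h₁ h₂
    obtain ⟨rfl, h₃⟩ := h₁.resolve_left fun hlt => by omega
    have h₂ : lexLt s γ := by simpa using h₂
    exact h.2 γ ⟨fun z hz => hpos z (by simp [hz]), by simpa using hsum⟩ ⟨h₂, h₃⟩

theorem AdjLtIn.append {p : List ℕ} (hp : ∀ x ∈ p, 0 < x) {m : ℕ} {s t : List ℕ}
    (h : AdjLtIn (posSeqs m) s t) :
    (Even p.length → AdjLtIn (posSeqs (p.sum + m)) (p ++ s) (p ++ t)) ∧
      (Odd p.length → AdjLtIn (posSeqs (p.sum + m)) (p ++ t) (p ++ s)) := by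
  induction p with
  | nil => simpa using h
  | cons x p ih =>
    obtain ⟨ihe, iho⟩ := ih fun y hy => hp y (by simp [hy])
    have hx : 0 < x := hp x (by simp)
    rw [List.sum_cons, add_assoc, List.length_cons]
    exact ⟨fun he => (iho (by grind)).cons hx, fun ho => (ihe (by grind)).cons hx⟩

theorem adjLtIn_split_singleton (b : ℕ) : AdjLtIn (posSeqs (b + 1)) [b, 1] [b + 1] := by
  refine ⟨(lexLt_cons_cons ..).2 (Or.inl (by omega)), ?_⟩
  rintro (_ | ⟨x, _ | ⟨y, γ⟩⟩) ⟨hpos, hsum⟩ ⟨h₁, h₂⟩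
  · simp at hsum
  · simp at hsum
    subst hsum
    exact not_lexLt_self _ h₂
  · simp at hpos hsum
    rw [lexLt_cons_cons] at h₁ h₂
    obtain ⟨rfl, h₃⟩ := h₁.resolve_left fun hlt => by omega
    rw [lexLt_cons_cons] at h₃
    obtain ⟨rfl, h₄⟩ := h₃.resolve_left fun hlt => by omega
    rcases γ with _ | ⟨z, γ⟩
    · exact not_lexLt_self _ h₄
    · simp at hpos hsum
      omega

theorem adjLtIn_split_pair (b c : ℕ) :
    AdjLtIn (posSeqs (b + 1 + c)) [b, 1, c] [b + 1, c] := by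
  have key : ∀ γ : List ℕ, (∀ x ∈ γ, 0 < x) → γ.sum = c → ¬ lexLt [c] γ := by
    rintro (_ | ⟨x, γ⟩) hpos hsum h
    · obtain rfl : 0 = c := by simpa using hsum
      obtain ⟨_ | i, -, h⟩ := h <;> simp [Al] at h
    · simp at hpos hsum
      rw [lexLt_cons_cons] at h
      rcases h with h | ⟨rfl, h⟩
      · omega
      · rcases γ with _ | ⟨z, γ⟩
        · exact not_lexLt_self _ h
        · simp at hpos hsum
          omega
  refine ⟨(lexLt_cons_cons ..).2 (Or.inl (by omega)), ?_⟩
  rintro (_ | ⟨x, γ⟩) ⟨hpos, hsum⟩ ⟨h₁, h₂⟩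
  · simp at hsum
    omega
  · rw [lexLt_cons_cons] at h₁ h₂
    have hpos' : ∀ z ∈ γ, 0 < z := fun z hz => hpos z (by simp [hz])
    rw [List.sum_cons] at hsum
    rcases h₂ with h₂ | ⟨rfl, h₂⟩
    · obtain ⟨rfl, h₃⟩ := h₁.resolve_left fun hlt => by omega
      rcases γ with _ | ⟨y, γ⟩
      · simp at hsum
        omega
      · rw [lexLt_cons_cons] at h₃
        have hy : 0 < y := hpos' y (by simp)
        obtain ⟨rfl, h₄⟩ := h₃.resolve_left fun hlt => by omega
        rw [List.sum_cons] at hsum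
        exact key γ (fun z hz => hpos' z (by simp [hz])) (by omega) h₄
    · exact key γ hpos' (by omega) h₂

theorem adjLtIn_split (b : ℕ) {r : List ℕ} (hr : r.length ≤ 1) :
    AdjLtIn (posSeqs (b + 1 + r.sum)) (b :: 1 :: r) ((b + 1) :: r) := by
  rcases r with _ | ⟨c, _ | ⟨d, r⟩⟩
  · exact adjLtIn_split_singleton b
  · exact adjLtIn_split_pair b c
  · simp at hr

theorem applyEs_append (p : List ℕ) (a : ℕ) (r : List ℕ) :
    applyEs (p ++ a :: r) (p.length + 1) = p ++ (a - 1) :: 1 :: r := by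
  simp [applyEs, List.drop_append]

theorem applyEc_append (q : List ℕ) (b a : ℕ) (r : List ℕ) :
    applyEc (q ++ b :: a :: r) (q.length + 2) = q ++ (b + 1) :: r := by
  simp [applyEc, List.drop_append]

/-- applying an elementary operation on the tail of the longest left
sequence of odd length (the largest odd index `≤ l(α)`), when applicable, gives
the immediate predecessor of `α` in `A_n`. -/
theorem stmt_4 (n : ℕ) (hn : 2 ≤ n) (α : List ℕ) (hα : α ∈ Aset n)
    (i : ℕ) (hi : i = if Even α.length then α.length - 1 else α.length)
    (happ : 1 < α.getD (i - 1) 0 ∨ (α.getD (i - 1) 0 = 1 ∧ 2 ≤ i))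
    (α' : List ℕ) (hop : ElemOpAt α i α') :
    α' ∈ Aset n ∧ AdjLtIn (Aset n) α' α := by
  obtain ⟨⟨hne, hpos⟩, hsum⟩ := hα
  have hlen : 0 < α.length := List.length_pos_of_ne_nil hne
  obtain ⟨p, a, r, rfl, hp, hr, rfl⟩ : ∃ p a r, α = p ++ a :: r ∧ Even p.length ∧
      r.length ≤ 1 ∧ i = p.length + 1 := by
    have hlt : i - 1 < α.length := by split_ifs at hi <;> omega
    refine ⟨α.take (i - 1), α[i - 1], α.drop (i - 1 + 1), by simp, ?_, ?_, ?_⟩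
    all_goals
      simp only [List.length_take, List.length_drop, Nat.min_eq_left hlt.le]
      grind
  have hmono : ∀ {s t}, AdjLtIn (posSeqs n) s t → AdjLtIn (Aset n) s t :=
    fun h => ⟨h.1, fun γ hγ => h.2 γ ⟨hγ.1.2, hγ.2⟩⟩
  rcases hop with ⟨⟨-, -, ha⟩, rfl⟩ | ⟨⟨hi2, -, ha⟩, rfl⟩
  · obtain ⟨b, rfl⟩ : ∃ b, a = b + 1 := ⟨a - 1, by simp at ha; omega⟩
    rw [applyEs_append, Nat.add_sub_cancel]
    have hb : 0 < b := by simpa using ha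
    have hadj := ((adjLtIn_split b hr).append
      (p := p) fun x hx => hpos x (by simp [hx])).1 hp
    rw [show p.sum + (b + 1 + r.sum) = n by simpa using hsum] at hadj
    refine ⟨⟨⟨by simp, ?_⟩, ?_⟩, hmono hadj⟩
    · simp only [List.mem_append, List.mem_cons] at hpos ⊢
      rintro x (hx | rfl | rfl | hx)
      exacts [hpos x (.inl hx), hb, one_pos, hpos x (.inr (.inr hx))]
    · simp at hsum ⊢
      omega
  · obtain rfl : a = 1 := by simpa using ha
    obtain ⟨q, b, rfl⟩ : ∃ q b, p = q ++ [b] :=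
      (List.eq_nil_or_concat' p).resolve_left (by rintro rfl; simp at hi2)
    rw [List.append_assoc, List.singleton_append] at *
    rw [List.length_append, List.length_singleton, applyEc_append]
    have hadj := ((adjLtIn_split b hr).append
      (p := q) fun x hx => hpos x (by simp [hx])).2 (by simp at hp; grind)
    rw [show q.sum + (b + 1 + r.sum) = n by simp at hsum; omega] at hadj
    refine ⟨⟨⟨by simp, ?_⟩, ?_⟩, hmono hadj⟩
    · simp only [List.mem_append, List.mem_cons] at hpos ⊢
      rintro x (hx | rfl | hx)
      exacts [hpos x (.inl hx), Nat.succ_pos _, hpos x (.inr (.inr (.inr hx)))]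
    · simp at hsum ⊢
      omega
end

section
/- Let n ≥ 2. For α ∈ A_n with α ≠ (n) (so that l(α) ≥ 2), define F(α) ∈ A_n as the result of applying one elementary operation on the tail of the longest left sequence of even length of α (i.e., whichever of E_s, E_c is applicable at the largest even index ≤ l(α)). Then the iterates (1, n−1), F((1, n−1)), F²((1, n−1)), … form a strictly increasing chain in the lexical order, this chain contains every element of A_n, and it terminates at (n). -/
theorem Al_cons_cons (x y j : ℕ) (γ : List ℕ) : Al (x :: y :: γ) (j + 2) = Al γ j := by
  simp [Al, pow_succ]

theorem lexLt_of_head {a b : ℕ} {γ δ : List ℕ} (h : a < b) : lexLt (a :: γ) (b :: δ) :=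
  ⟨0, by simp, by simpa [Al] using h⟩

theorem lexLt_of_second {x a b : ℕ} {γ δ : List ℕ} (h : b < a) :
    lexLt (x :: a :: γ) (x :: b :: δ) :=
  ⟨1, by simp [Al], by simpa [Al] using h⟩

theorem lexLt_cons_cons_s7 (x y : ℕ) {γ δ : List ℕ} (h : lexLt γ δ) :
    lexLt (x :: y :: γ) (x :: y :: δ) := by
  obtain ⟨i, h₁, h₂⟩ := h
  refine ⟨i + 2, fun j hj => ?_, by simpa only [Al_cons_cons] using h₂⟩
  match j, hj with
  | 0, _ => simp [Al]
  | 1, _ => simp [Al]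
  | j + 2, hj => simpa only [Al_cons_cons] using h₁ j (by omega)

theorem lexLt_irrefl (α : List ℕ) : ¬ lexLt α α := fun ⟨_, _, h⟩ => lt_irrefl _ h

theorem lexLt_trans {α β γ : List ℕ} (h₁ : lexLt α β) (h₂ : lexLt β γ) : lexLt α γ :=
  lt_trans (α := Lex (ℕ → ℤ)) (a := toLex (Al α)) (b := toLex (Al β)) (c := toLex (Al γ)) h₁ h₂

instance : IsStrictOrder (List ℕ) lexLt where
  irrefl := lexLt_irrefl
  trans _ _ _ := lexLt_trans

theorem finite_Aset (n : ℕ) : (Aset n).Finite :=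
  (Set.finite_range (Composition.blocks (n := n))).subset fun α hα =>
    ⟨⟨α, fun {i} hi => hα.1.2 i hi, hα.2⟩, rfl⟩

theorem succOp_cons_cons (x y : ℕ) {γ : List ℕ} (hγ : 2 ≤ γ.length) :
    succOp (x :: y :: γ) = x :: y :: succOp γ := by
  obtain ⟨k, hk, hk'⟩ : ∃ k, (if Even γ.length then γ.length else γ.length - 1) = k + 2 ∧
      (if Even (x :: y :: γ).length then (x :: y :: γ).length
        else (x :: y :: γ).length - 1) = k + 4 := by
    by_cases h : Even γ.length
    · exact ⟨γ.length - 2, by simp [h]; omega, by simp [h]; omega⟩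
    · have : γ.length ≠ 2 := fun h' => h (by simp [h'])
      exact ⟨γ.length - 3, by simp [h]; omega, by simp [h, Nat.even_add]; omega⟩
  simp only [succOp, hk, hk', applyEs, applyEc]
  rw [apply_ite (fun l => x :: y :: l)]
  simp

theorem succOp_pair_of_one_lt (x : ℕ) {y : ℕ} (hy : 1 < y) :
    succOp [x, y] = [x, y - 1, 1] := by
  simp [succOp, applyEs, hy]

theorem succOp_pair_one (x : ℕ) : succOp [x, 1] = [x + 1] := by
  simp [succOp, applyEc]

theorem succOp_triple_of_one_lt (x : ℕ) {y : ℕ} (z : ℕ) (hy : 1 < y) :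
    succOp [x, y, z] = [x, y - 1, 1, z] := by
  simp [succOp, applyEs, hy, Nat.even_add_one]

theorem succOp_triple_one (x z : ℕ) : succOp [x, 1, z] = [x + 1, z] := by
  simp [succOp, applyEc, Nat.even_add_one]

/-- Except for `(1)` and `(1, b)`, every α-sequence is the successor of a smaller α-sequence
of the same degree and of length at least two. -/
theorem exists_succOp_eq : ∀ β : List ℕ, IsAlphaSeq β → β ≠ [1] → (∀ b, β ≠ [1, b]) →
    ∃ α, IsAlphaSeq α ∧ α.sum = β.sum ∧ 2 ≤ α.length ∧ succOp α = β ∧ lexLt α β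
  | [], h, _, _ => absurd rfl h.1
  | [b], h, h₁, _ => by
    have hb : 0 < b := h.2 b (by simp)
    have hb1 : b ≠ 1 := by simpa using h₁
    refine ⟨[b - 1, 1], ⟨by simp, by simp; omega⟩, by simp; omega, by simp, ?_,
      lexLt_of_head (by omega)⟩
    rw [succOp_pair_one, Nat.sub_add_cancel hb]
  | [a, b], h, _, h₂ => by
    have ha : 0 < a := h.2 a (by simp)
    have hb : 0 < b := h.2 b (by simp)
    have ha1 : a ≠ 1 := by simpa using h₂ b
    refine ⟨[a - 1, 1, b], ⟨by simp, by simp; omega⟩, by simp; omega, by simp, ?_,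
      lexLt_of_head (by omega)⟩
    rw [succOp_triple_one, Nat.sub_add_cancel ha]
  | x :: y :: c :: γ, h, _, _ => by
    have hx : 0 < x := h.2 x (by simp)
    have hy : 0 < y := h.2 y (by simp)
    by_cases h₁ : c :: γ = [1]
    · rw [h₁]
      refine ⟨[x, y + 1], ⟨by simp, by simp; omega⟩, by simp, by simp, ?_,
        lexLt_of_second (by omega)⟩
      rw [succOp_pair_of_one_lt _ (by omega), Nat.add_sub_cancel]
    by_cases h₂ : ∃ b, c :: γ = [1, b]
    · obtain ⟨b, hb⟩ := h₂
      have hb0 : 0 < b := h.2 b (by simp [hb])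
      rw [hb]
      refine ⟨[x, y + 1, b], ⟨by simp, by simp; omega⟩, by simp; omega, by simp, ?_,
        lexLt_of_second (by omega)⟩
      rw [succOp_triple_of_one_lt _ _ (by omega), Nat.add_sub_cancel]
    obtain ⟨α, hα, hs, hl, he, hlt⟩ := exists_succOp_eq (c :: γ)
      ⟨by simp, fun z hz => h.2 z (by simp at hz ⊢; tauto)⟩ h₁ (not_exists.mp h₂)
    refine ⟨x :: y :: α, ⟨by simp, fun z hz => ?_⟩, by simpa using hs, by simp, ?_,
      lexLt_cons_cons_s7 x y hlt⟩
    · simp only [List.mem_cons] at hz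
      rcases hz with rfl | rfl | hz
      exacts [hx, hy, hα.2 z hz]
    · rw [succOp_cons_cons x y hl, he]

/-- Every `β` in `A_n` is reached from `(1, n - 1)` by an increasing chain of successors that
does not meet `(n)` before `β`. -/
theorem exists_iterate_succOp_eq {n : ℕ} (hn : 2 ≤ n) {β : List ℕ} (hβ : β ∈ Aset n) :
    ∃ j, succOp^[j] [1, n - 1] = β ∧ ∀ i < j, succOp^[i] [1, n - 1] ≠ [n] ∧
      lexLt (succOp^[i] [1, n - 1]) (succOp^[i + 1] [1, n - 1]) := by
  have hwf : (Aset n).WellFoundedOn lexLt := (finite_Aset n).wellFoundedOn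
  refine hwf.induction (P := fun β => ∃ j, succOp^[j] [1, n - 1] = β ∧ ∀ i < j,
    succOp^[i] [1, n - 1] ≠ [n] ∧
      lexLt (succOp^[i] [1, n - 1]) (succOp^[i + 1] [1, n - 1])) hβ fun β hβ ih => ?_
  by_cases h : ∃ b, β = [1, b]
  · obtain ⟨b, rfl⟩ := h
    have : b = n - 1 := by have := hβ.2; simp at this; omega
    exact ⟨0, by simp [this], by simp⟩
  have h₁ : β ≠ [1] := by
    rintro rfl
    have := hβ.2
    simp at this
    omega
  obtain ⟨α, hα, hs, hl, he, hlt⟩ := exists_succOp_eq β hβ.1 h₁ (not_exists.mp h)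
  obtain ⟨j, hj, hchain⟩ := ih α ⟨hα, hs.trans hβ.2⟩ hlt
  have hj' : succOp^[j + 1] [1, n - 1] = β := by rw [Function.iterate_succ_apply', hj, he]
  refine ⟨j + 1, hj', fun i hi => ?_⟩
  rcases Nat.lt_succ_iff_lt_or_eq.mp hi with hi | rfl
  · exact hchain i hi
  · rw [hj, hj']
    exact ⟨fun h => by simp [h] at hl, hlt⟩

/-- the iterates of the successor operation starting from `(1, n-1)`
form a strictly increasing chain which exhausts `A_n` and terminates at `(n)`. -/
theorem stmt_7 (n : ℕ) (hn : 2 ≤ n) :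
    ∃ N : ℕ,
      succOp^[N] [1, n - 1] = [n] ∧
      (∀ j < N, lexLt (succOp^[j] [1, n - 1]) (succOp^[j + 1] [1, n - 1])) ∧
      (∀ β ∈ Aset n, ∃ j ≤ N, succOp^[j] [1, n - 1] = β) := by
  have hmem : [n] ∈ Aset n := ⟨⟨by simp, by simp; omega⟩, by simp⟩
  obtain ⟨N, hN, hchain⟩ := exists_iterate_succOp_eq hn hmem
  refine ⟨N, hN, fun j hj => (hchain j hj).2, fun β hβ => ?_⟩
  obtain ⟨j, hj, hne⟩ := exists_iterate_succOp_eq hn hβ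
  exact ⟨j, not_lt.mp fun h => (hne N h).1 hN, hj⟩
end

section
/- Let τ be a lexical α-sequence and let r ≥ 3 be odd. Set g = τ ⋆ (2, 1^{r−3}) (where (2, 1^0) means the one-element sequence (2)) and ĝ = τ ⋆ (1^{r−1}). Then g_o ĝ = τ ⋆ (3, 1, 1) if r = 3, and g_o ĝ = τ ⋆ (2, 1^{r−4}, 2, 1^{r−1}) if r ≥ 5; in particular, g_o ĝ is lexical. -/
/-- The alternating lexicographic comparison of two sequences of naturals. -/
def AltLt (f g : ℕ → ℕ) : Prop :=
  ∃ j, (∀ l < j, f l = g l) ∧ ((Even j ∧ f j < g j) ∨ (Odd j ∧ g j < f j))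

theorem Al_eq_iff (s t : List ℕ) (i : ℕ) : Al s i = Al t i ↔ s.getD i 0 = t.getD i 0 := by
  have h : ((-1 : ℤ) ^ i) ≠ 0 := by positivity
  unfold Al
  rw [mul_right_inj' h]
  exact Nat.cast_inj

theorem Al_lt_iff (s t : List ℕ) (i : ℕ) :
    Al s i < Al t i ↔ (Even i ∧ s.getD i 0 < t.getD i 0) ∨ (Odd i ∧ t.getD i 0 < s.getD i 0) := by
  unfold Al
  rcases Nat.even_or_odd i with h | h
  · simp only [h.neg_one_pow, h, Nat.not_odd_iff_even.mpr h]
    simp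
  · simp only [h.neg_one_pow, h, Nat.not_even_iff_odd.mpr h]
    simp

theorem lexLt_iff (s t : List ℕ) :
    lexLt s t ↔ AltLt (fun l => s.getD l 0) (fun l => t.getD l 0) := by
  unfold lexLt AltLt
  simp only [Al_eq_iff, Al_lt_iff]

theorem lexLt_cons (a b : ℕ) (s t : List ℕ) :
    lexLt (a :: s) (b :: t) ↔ a < b ∨ (a = b ∧ lexLt t s) := by
  simp only [lexLt_iff, AltLt]
  constructor
  · rintro ⟨j, h, hj⟩
    rcases j with _ | j
    · left; simpa using hj
    · right
      refine ⟨by simpa using h 0 (by omega), j, fun l hl => ?_, ?_⟩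
      · simpa using (h (l + 1) (by omega)).symm
      · simp only [List.getD_cons_succ] at hj
        grind
  · rintro (h | ⟨rfl, j, h, hj⟩)
    · exact ⟨0, by simp, by simpa using h⟩
    · refine ⟨j + 1, fun l hl => ?_, ?_⟩
      · rcases l with _ | l
        · simp
        · simpa using (h l (by omega)).symm
      · simp only [List.getD_cons_succ]
        grind

theorem lexLt_append_even (u s t : List ℕ) (hu : Even u.length) (h : lexLt s t) :
    lexLt (u ++ s) (u ++ t) := by
  induction hn : u.length using Nat.strong_induction_on generalizing u with
  | _ n ih =>
    match u, hu, hn with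
    | [], _, _ => simpa using h
    | [a], hu, _ => simp at hu
    | a :: b :: u, hu, hn =>
      simp only [List.cons_append, lexLt_cons]
      refine Or.inr ⟨trivial, Or.inr ⟨trivial, ih u.length ?_ u ?_ rfl⟩⟩
      · simp at hn; omega
      · simp only [List.length_cons] at hu; grind

theorem lexLt_append_odd (u s t : List ℕ) (hu : Odd u.length) (h : lexLt t s) :
    lexLt (u ++ s) (u ++ t) := by
  rcases u with _ | ⟨a, u⟩
  · simp at hu
  · simp only [List.cons_append, lexLt_cons]
    refine Or.inr ⟨trivial, lexLt_append_even u t s ?_ h⟩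
    simp only [List.length_cons] at hu
    grind

theorem odd_length_seqO (τ : List ℕ) (h : τ ≠ []) : Odd (seqO τ).length := by
  have := List.length_pos_iff.mpr h
  unfold seqO bumpLast
  split_ifs <;> simp <;> grind

theorem even_length_seqE (τ : List ℕ) (h : τ ≠ []) : Even (seqE τ).length := by
  have := List.length_pos_iff.mpr h
  unfold seqE bumpLast
  split_ifs <;> simp <;> grind

/-- `t` restricted to `[0, k)` strictly exceeds its proper tails; the tail starting at `i` is
compared with `t` at an index at most `k - i`. -/
def TailsLt (t : ℕ → ℕ) (k : ℕ) : Prop :=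
  ∀ i, 1 ≤ i → i < k → ∃ j ≤ k - i, (∀ l < j, t (i + l) = t l) ∧
    ((j < k - i ∧ Even j ∧ t (i + j) < t j) ∨ (j < k - i ∧ Odd j ∧ t j < t (i + j)) ∨
      (j = k - i ∧ Even j ∧ 0 < t j))

/-- `f` begins with the odd-length modification of the length `k` sequence `t`. -/
structure OddStart (t f : ℕ → ℕ) (k : ℕ) : Prop where
  agree : ∀ l, l + 1 < k → f l = t l
  last_odd : Odd k → f (k - 1) = t (k - 1) + 1
  last_even : Even k → f (k - 1) = t (k - 1)
  next_even : Even k → f k = 1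

theorem OddStart.le {t f : ℕ → ℕ} {k : ℕ} (hf : OddStart t f k) (l : ℕ) (hl : l < k) :
    t l ≤ f l := by
  obtain ⟨h1, h2, h3, -⟩ := hf
  by_cases h : l + 1 < k
  · rw [h1 l h]
  · obtain rfl : l = k - 1 := by omega
    rcases Nat.even_or_odd k with hk | hk
    · rw [h3 hk]
    · rw [h2 hk]; omega

theorem OddStart.tail_lt {t f : ℕ → ℕ} {k : ℕ} (ht : TailsLt t k) (hf : OddStart t f k)
    (p : ℕ) (hp : Odd p) (hpk : p < k) :
    ∃ j, p + j < k ∧ (∀ l < j, f (p + l) = t l) ∧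
      ((Even j ∧ f (p + j) < t j) ∨ (Odd j ∧ t j < f (p + j))) := by
  obtain ⟨j, hjk, hag, hj⟩ := ht p hp.pos hpk
  obtain ⟨h1, h2, h3, -⟩ := hf
  rcases Nat.even_or_odd k with hk | hk
  · have hft : ∀ l, p + l < k → f (p + l) = t (p + l) := by
      intro l hl
      by_cases h : p + l + 1 < k
      · exact h1 _ h
      · rw [show p + l = k - 1 by omega]; exact h3 hk
    have hlt : j < k - p := by grind
    refine ⟨j, by omega, fun l hl => ?_, ?_⟩
    · rw [hft l (by omega), hag l hl]
    · rw [hft j (by omega)]; grind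
  · by_cases hlt : j + 1 < k - p
    · refine ⟨j, by omega, fun l hl => ?_, ?_⟩
      · rw [h1 _ (by omega), hag l hl]
      · rw [h1 _ (by omega)]; grind
    · refine ⟨k - p - 1, by omega, fun l hl => ?_, Or.inr ⟨by grind, ?_⟩⟩
      · rw [h1 _ (by omega), hag l (by omega)]
      · rw [show p + (k - p - 1) = k - 1 by omega, h2 hk]
        rcases Nat.lt_or_ge (k - p - 1) j with h | h
        · have := hag _ h
          rw [show p + (k - p - 1) = k - 1 by omega] at this
          omega
        · obtain rfl : j = k - p - 1 := by omega
          rw [show p + (k - p - 1) = k - 1 by omega] at hj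
          grind

theorem OddStart.altLt_of_prefix {t f s : ℕ → ℕ} {k : ℕ} (ht : TailsLt t k) (hf : OddStart t f k)
    (p : ℕ) (hp : Odd p) (hpk : p < k) (hs : ∀ l < p, s l = f l)
    (hst : ∀ l, l + 1 < k → s (p + l) = t l) : AltLt s f := by
  obtain ⟨j, hjk, hag, hj⟩ := hf.tail_lt ht p hp hpk
  have := hp.pos
  refine ⟨p + j, fun l hl => ?_, ?_⟩
  · by_cases h : l < p
    · exact hs l h
    · obtain ⟨m, rfl⟩ := Nat.exists_eq_add_of_le (Nat.le_of_not_lt h)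
      rw [hst m (by omega), hag m (by omega)]
  · rw [hst j (by omega)]
    grind

theorem OddStart.altLt_bumped_tail {t f s : ℕ → ℕ} {k : ℕ} (ht : TailsLt t k)
    (hf : OddStart t f k) (i : ℕ) (hi : 1 ≤ i) (hik : i < k)
    (hs : ∀ l, i + l + 1 < k → s l = t (i + l)) (hlast : s (k - 1 - i) = t (k - 1) + 1)
    (hst : ∀ l, l + 1 < k → s (k - i + l) = t l) : AltLt s f := by
  obtain ⟨j, hjk, hag, hj⟩ := ht i hi hik
  by_cases hlt : j + 1 < k - i
  · refine ⟨j, fun l hl => ?_, ?_⟩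
    · rw [hs l (by omega), hag l hl, hf.agree l (by omega)]
    · rw [hs j (by omega), hf.agree j (by omega)]; grind
  have hagf : ∀ l < k - 1 - i, s l = f l := fun l hl => by
    rw [hs l (by omega), hag l (by omega), hf.agree l (by omega)]
  have e : i + (k - 1 - i) = k - 1 := by omega
  have hfi : f (k - 1 - i) = t (k - 1 - i) := hf.agree _ (by omega)
  rcases Nat.even_or_odd (k - 1 - i) with hev | hod
  · have hj' : j = k - 1 - i := by grind
    subst hj'
    rw [e] at hj
    by_cases heq : t (k - 1) + 1 = t (k - 1 - i)
    · refine hf.altLt_of_prefix ht (k - i) ?_ (by omega) (fun l hl => ?_) hst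
      · have : k - i = (k - 1 - i) + 1 := by omega
        rw [this]; exact hev.add_one
      · by_cases h : l < k - 1 - i
        · exact hagf l h
        · obtain rfl : l = k - 1 - i := by omega
          omega
    · refine ⟨k - 1 - i, hagf, Or.inl ⟨hev, ?_⟩⟩
      grind
  · refine ⟨k - 1 - i, hagf, Or.inr ⟨hod, ?_⟩⟩
    rw [hlast, hfi]
    rcases Nat.lt_or_ge (k - 1 - i) j with h | h
    · have := hag _ h
      rw [e] at this
      omega
    · obtain rfl : j = k - 1 - i := by omega
      rw [e] at hj
      grind

theorem OddStart.altLt_extended_tail {t f s : ℕ → ℕ} {k : ℕ} (ht : TailsLt t k)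
    (hpos : ∀ l < k, 0 < t l)
    (hf : OddStart t f k) (i : ℕ) (hi : 1 ≤ i) (hik : i ≤ k)
    (hs : ∀ l, i + l < k → s l = t (i + l)) (hlast : s (k - i) = 1)
    (hst : ∀ l, l + 1 < k → s (k - i + 1 + l) = t l) : AltLt s f := by
  obtain ⟨j, hjk, hag, hj⟩ : ∃ j ≤ k - i, (∀ l < j, t (i + l) = t l) ∧
    ((j < k - i ∧ Even j ∧ t (i + j) < t j) ∨ (j < k - i ∧ Odd j ∧ t j < t (i + j)) ∨
      (j = k - i ∧ Even j ∧ 0 < t j)) := by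
    rcases Nat.lt_or_ge i k with h | h
    · exact ht i hi h
    · exact ⟨0, by omega, by simp, Or.inr (Or.inr ⟨by omega, by simp, hpos 0 (by omega)⟩)⟩
  have hagf : ∀ l < j, s l = f l := fun l hl => by
    rw [hs l (by omega), hag l (by omega), hf.agree l (by omega)]
  by_cases hlt : j < k - i
  · refine ⟨j, hagf, ?_⟩
    rw [hs j (by omega), hf.agree j (by omega)]; grind
  obtain ⟨rfl, hev, h0⟩ : j = k - i ∧ Even j ∧ 0 < t j := by grind
  have hle := hf.le (k - i) (by omega)
  by_cases heq : f (k - i) = 1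
  · have hodd : Odd (k - i + 1) := hev.add_one
    refine hf.altLt_of_prefix ht (k - i + 1) hodd ?_ (fun l hl => ?_) hst
    · by_contra hcon
      have e : k - i = k - 1 := by omega
      have := hf.last_odd (by grind)
      rw [e] at heq h0
      omega
    · by_cases h : l < k - i
      · exact hagf l h
      · obtain rfl : l = k - i := by omega
        omega
  · exact ⟨k - i, hagf, Or.inl ⟨hev, by omega⟩⟩

theorem OddStart.altLt_tail {t f s : ℕ → ℕ} {k : ℕ} (ht : TailsLt t k)
    (hf : OddStart t f k) (i : ℕ) (hi : 1 ≤ i) (hik : i < k)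
    (hs : ∀ l, i + l < k → s l = t (i + l)) (hlast : s (k - i) = 0) : AltLt s f := by
  obtain ⟨j, hjk, hag, hj⟩ := ht i hi hik
  refine ⟨j, fun l hl => ?_, ?_⟩
  · rw [hs l (by omega), hag l hl, hf.agree l (by omega)]
  · by_cases hlt : j < k - i
    · rw [hs j (by omega), hf.agree j (by omega)]; grind
    · obtain ⟨rfl, hev, h0⟩ : j = k - i ∧ Even j ∧ 0 < t j := by grind
      have := hf.le (k - i) (by omega)
      exact Or.inl ⟨hev, by omega⟩

theorem IsLexical.lexLt_of_suffix {α y : List ℕ} (h : IsLexical α) (hy : y <:+ α)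
    (hne : y ≠ []) (hlt : y ≠ α) : lexLt y α := by
  obtain ⟨x, rfl⟩ := hy
  have hx : x ≠ [] := by rintro rfl; simp at hlt
  have h1 := List.length_pos_iff.mpr hx
  have h2 := List.length_pos_iff.mpr hne
  have := h.2 (x.length + 1) (by omega) (by simp; omega)
  simpa using this

theorem IsLexical.tailsLt {τ : List ℕ} (h : IsLexical τ) :
    TailsLt (fun l => τ.getD l 0) τ.length := by
  intro i hi hik
  have hpos : ∀ l < τ.length, 0 < τ.getD l 0 := fun l hl => by
    rw [List.getD_eq_getElem _ _ hl]
    exact h.1.2 _ (List.getElem_mem hl)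
  have hlt := h.2 (i + 1) (by omega) (by omega)
  rw [lexLt_iff] at hlt
  obtain ⟨j, hag, hj⟩ := hlt
  have hd : ∀ l, (τ.drop (i + 1 - 1)).getD l 0 = τ.getD (i + l) 0 := fun l => by
    simp [List.getD_eq_getElem?_getD]
  simp only [hd] at hag hj
  have hz : τ.getD (i + (τ.length - i)) 0 = 0 := by
    rw [List.getD_eq_default]; omega
  have hjk : j ≤ τ.length - i := by
    by_contra hcon
    have := hag (τ.length - i) (by omega)
    have := hpos (τ.length - i) (by omega)
    omega
  refine ⟨j, hjk, hag, ?_⟩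
  rcases Nat.lt_or_ge j (τ.length - i) with h | h
  · grind
  · obtain rfl : j = τ.length - i := by omega
    have := hpos (τ.length - i) (by omega)
    rw [hz] at hj
    grind

theorem bumpLast_append_singleton (T : List ℕ) (a : ℕ) : bumpLast (T ++ [a]) = T ++ [a + 1] := by
  simp [bumpLast]

theorem oddStart_seqO (τ z : List ℕ) (h : τ ≠ []) :
    OddStart (fun l => τ.getD l 0) (fun l => (seqO τ ++ z).getD l 0) τ.length := by
  obtain ⟨T, a, rfl⟩ := List.eq_nil_or_concat' τ |>.resolve_left h
  unfold seqO
  simp only [bumpLast_append_singleton]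
  constructor
  · intro l hl
    simp only [List.length_append, List.length_singleton] at hl
    split_ifs <;> simp [List.getD_eq_getElem?_getD, List.getElem?_append, show l < T.length by omega]
  · intro hk
    rw [if_neg (Nat.not_even_iff_odd.mpr hk)]
    simp [List.getD_eq_getElem?_getD]
  · intro hk
    rw [if_pos hk]
    simp [List.getD_eq_getElem?_getD]
  · intro hk
    rw [if_pos hk]
    simp [List.getD_eq_getElem?_getD]

/-- `y` is below every sequence that begins with `τ_o`. -/
def BelowO (τ y : List ℕ) : Prop := ∀ z, lexLt y (seqO τ ++ z)

theorem belowO_self (τ : List ℕ) (h : τ ≠ []) : BelowO τ τ := by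
  intro z
  obtain ⟨T, a, rfl⟩ := List.eq_nil_or_concat' τ |>.resolve_left h
  have hf := oddStart_seqO _ z h
  rw [lexLt_iff]
  simp only [List.length_append, List.length_singleton] at hf
  rcases Nat.even_or_odd (T.length + 1) with hk | hk
  · refine ⟨T.length + 1, fun l hl => ?_, Or.inl ⟨hk, ?_⟩⟩
    · by_cases hl' : l + 1 < T.length + 1
      · exact (hf.agree l hl').symm
      · obtain rfl : l = T.length := by omega
        exact (hf.last_even hk).symm
    · have := hf.next_even hk
      dsimp only at this ⊢
      rw [this]
      simp [List.getD_eq_getElem?_getD]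
  · refine ⟨T.length, fun l hl => (hf.agree l (by omega)).symm, Or.inl ⟨by grind, ?_⟩⟩
    have := hf.last_odd hk
    simp only [Nat.add_sub_cancel] at this ⊢
    rw [this]
    omega

theorem seqE_append_lexLt (τ x : List ℕ) (h : τ ≠ []) : lexLt (seqE τ ++ x) τ := by
  obtain ⟨T, a, rfl⟩ := List.eq_nil_or_concat' τ |>.resolve_left h
  unfold seqE
  rw [bumpLast_append_singleton]
  split_ifs with hk
  · simp only [List.append_assoc]
    refine lexLt_append_odd _ _ _ ?_ ?_
    · simp at hk; grind
    · simp [lexLt_cons]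
  · rw [lexLt_iff]
    refine ⟨T.length + 1, fun l hl => ?_, Or.inr ⟨by simpa using hk, ?_⟩⟩
    · dsimp only
      rw [List.append_assoc, List.getD_append _ _ _ _ (by simpa using hl)]
    · simp [List.getD_eq_getElem?_getD]

theorem belowO_seqE_append (τ x : List ℕ) (h : τ ≠ []) : BelowO τ (seqE τ ++ x) := by
  intro z
  obtain ⟨i, hi, hi'⟩ := belowO_self τ h z
  obtain ⟨j, hj, hj'⟩ := seqE_append_lexLt τ x h
  rcases lt_trichotomy i j with hij | rfl | hij
  · exact ⟨i, fun l hl => (hj l (by omega)).trans (hi l hl), (hj i hij).trans_lt hi'⟩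
  · exact ⟨i, fun l hl => (hj l hl).trans (hi l hl), hj'.trans hi'⟩
  · exact ⟨j, fun l hl => (hj l hl).trans (hi l (by omega)), hj'.trans_eq (hi j hij)⟩

theorem getD_append_length_add (w y : List ℕ) (l d : ℕ) :
    (w ++ y).getD (w.length + l) d = y.getD l d := by
  rw [List.getD_append_right _ _ _ _ (by omega), Nat.add_sub_cancel_left]

theorem belowO_of_suffix (τ y : List ℕ) (h : IsLexical τ) (hy : y <:+ τ) (hne : y ≠ []) :
    BelowO τ y := by
  by_cases heq : y = τ
  · subst heq; exact belowO_self y h.1.1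
  · intro z
    obtain ⟨x, rfl⟩ := hy
    have hx : x ≠ [] := by rintro rfl; simp at heq
    have h1 := List.length_pos_iff.mpr hx
    have h2 := List.length_pos_iff.mpr hne
    rw [lexLt_iff]
    refine (oddStart_seqO _ z h.1.1).altLt_tail h.tailsLt x.length h1 (by simp; omega)
      (fun l hl => ?_) ?_
    · rw [getD_append_length_add]
    · simp [List.getD_eq_getElem?_getD]

theorem belowO_of_block_suffix (τ u v x y : List ℕ) (h : IsLexical τ)
    (hu : u = bumpLast τ ∨ u = τ ++ [1]) (hy : y <:+ u) (hne : y ≠ []) (hlt : y ≠ u)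
    (hv : v = τ.dropLast ++ x) : BelowO τ (y ++ v) := by
  intro z
  have hpos : ∀ l < τ.length, 0 < τ.getD l 0 := fun l hl => by
    rw [List.getD_eq_getElem _ _ hl]
    exact h.1.2 _ (List.getElem_mem hl)
  have hf := oddStart_seqO τ z h.1.1
  have ht := h.tailsLt
  obtain ⟨w, rfl⟩ := hy
  have hw : w ≠ [] := by rintro rfl; simp at hlt
  have h1 := List.length_pos_iff.mpr hw
  obtain ⟨y, b, rfl⟩ := List.eq_nil_or_concat' y |>.resolve_left hne
  obtain ⟨T, a, rfl⟩ := List.eq_nil_or_concat' τ |>.resolve_left h.1.1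
  rw [bumpLast_append_singleton] at hu
  rw [List.dropLast_concat] at hv
  subst hv
  rw [lexLt_iff]
  rcases hu with hu | hu
  · rw [← List.append_assoc] at hu
    obtain ⟨rfl, hb⟩ := List.append_inj' hu rfl
    obtain rfl : b = a + 1 := by simpa using hb
    refine hf.altLt_bumped_tail ht w.length h1 (by simp) (fun l hl => ?_) ?_ (fun l hl => ?_)
    · simp only [List.length_append, List.length_singleton] at hl
      rw [List.append_assoc w y [a], getD_append_length_add, List.append_assoc y,
        List.getD_append _ _ _ _ (by omega), List.getD_append _ _ _ _ (by omega)]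
    · simp only [List.length_append, List.length_singleton]
      rw [show w.length + y.length + 1 - 1 - w.length = y.length by omega]
      simp [List.getD_eq_getElem?_getD]
    · simp only [List.length_append, List.length_singleton] at hl ⊢
      rw [show w.length + y.length + 1 - w.length + l = (y ++ [a + 1]).length + l by simp; omega,
        getD_append_length_add, List.getD_append (w ++ y) x _ _ (by simp; omega),
        List.getD_append (w ++ y) [a] _ _ (by simp; omega)]
  · rw [← List.append_assoc] at hu
    obtain ⟨hwy, hb⟩ := List.append_inj' hu rfl
    obtain rfl : b = 1 := by simpa using hb
    have hlen := congrArg List.length hwy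
    simp only [List.length_append, List.length_singleton] at hlen
    refine hf.altLt_extended_tail ht hpos w.length h1 (by simp; omega)
      (fun l hl => ?_) ?_ (fun l hl => ?_)
    · simp only [List.length_append, List.length_singleton] at hl
      rw [← hwy, getD_append_length_add, List.append_assoc, List.getD_append _ _ _ _ (by omega)]
    · simp only [List.length_append, List.length_singleton]
      rw [show T.length + 1 - w.length = y.length by omega]
      simp [List.getD_eq_getElem?_getD]
    · simp only [List.length_append, List.length_singleton] at hl ⊢
      rw [show T.length + 1 - w.length + 1 + l = (y ++ [1]).length + l by simp; omega,
        getD_append_length_add, List.getD_append _ _ _ _ (by omega),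
        List.getD_append _ _ _ _ (by omega)]

theorem seqO_eq (τ : List ℕ) : seqO τ = bumpLast τ ∨ seqO τ = τ ++ [1] := by
  unfold seqO; split_ifs <;> simp

theorem seqE_eq (τ : List ℕ) : seqE τ = bumpLast τ ∨ seqE τ = τ ++ [1] := by
  unfold seqE; split_ifs <;> simp

theorem dropLast_prefix_of_block {τ u : List ℕ} (hu : u = bumpLast τ ∨ u = τ ++ [1]) :
    τ.dropLast <+: u := by
  rcases hu with rfl | rfl
  · exact List.prefix_append _ _
  · exact (List.dropLast_prefix τ).trans (List.prefix_append _ _)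

theorem suffix_block_append (τ u v y : List ℕ) (h : IsLexical τ)
    (hu : u = bumpLast τ ∨ u = τ ++ [1]) (hv : τ.dropLast <+: v) (hy : y <:+ u ++ v) :
    y <:+ v ∨ y = u ++ v ∨ BelowO τ y := by
  obtain ⟨x, rfl⟩ := hv
  obtain ⟨w, hw⟩ := hy
  rcases List.append_eq_append_iff.mp hw with ⟨c, hc, rfl⟩ | ⟨c, rfl, hc⟩
  · by_cases hcn : c = []
    · subst hcn; left; simp
    by_cases hcu : c = u
    · subst hcu; right; left; rfl
    right; right
    exact belowO_of_block_suffix τ u _ x c h hu ⟨w, hc.symm⟩ hcn hcu rfl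
  · left; exact ⟨c, hc.symm⟩

theorem dropLast_prefix_nrep (τ v : List ℕ) (hv : τ.dropLast <+: v) (m : ℕ) :
    τ.dropLast <+: nrep (seqE τ) m ++ v := by
  rcases m with _ | m
  · simpa [nrep] using hv
  · simp only [nrep, List.replicate_succ, List.flatten_cons, List.append_assoc]
    exact (dropLast_prefix_of_block (seqE_eq τ)).trans (List.prefix_append _ _)

theorem suffix_nrep_append (τ v y : List ℕ) (h : IsLexical τ) (hv : τ.dropLast <+: v) (m : ℕ)
    (hy : y <:+ nrep (seqE τ) m ++ v) : y <:+ v ∨ BelowO τ y := by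
  induction m with
  | zero => left; simpa [nrep] using hy
  | succ m ih =>
    simp only [nrep, List.replicate_succ, List.flatten_cons, List.append_assoc] at hy
    rcases suffix_block_append τ _ _ y h (seqE_eq τ) (dropLast_prefix_nrep τ v hv m) hy with
      h' | rfl | h'
    · exact ih h'
    · exact Or.inr (belowO_seqE_append τ _ h.1.1)
    · exact Or.inr h'

theorem starProd_nil (τ : List ℕ) : starProd τ [] = τ := by simp [starProd]

theorem starProd_cons (τ β : List ℕ) (b : ℕ) :
    starProd τ (b :: β) = seqO τ ++ (nrep (seqE τ) (b - 1) ++ starProd τ β) := by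
  simp [starProd]

theorem dropLast_prefix_starProd (τ β : List ℕ) : τ.dropLast <+: starProd τ β := by
  rcases β with _ | ⟨b, β⟩
  · rw [starProd_nil]; exact List.dropLast_prefix τ
  · rw [starProd_cons]
    exact (dropLast_prefix_of_block (seqO_eq τ)).trans (List.prefix_append _ _)

theorem suffix_starProd (τ β y : List ℕ) (h : IsLexical τ) (hne : y ≠ [])
    (hy : y <:+ starProd τ β) : (∃ β', β' <:+ β ∧ y = starProd τ β') ∨ BelowO τ y := by
  induction β with
  | nil =>
    rw [starProd_nil] at hy
    exact Or.inr (belowO_of_suffix τ y h hy hne)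
  | cons b β ih =>
    have hpre := dropLast_prefix_starProd τ β
    rw [starProd_cons] at hy
    rcases suffix_block_append τ _ _ y h (seqO_eq τ) (dropLast_prefix_nrep τ _ hpre _) hy with
      h' | rfl | h'
    · rcases suffix_nrep_append τ _ y h hpre _ h' with h' | h'
      · rcases ih h' with ⟨β', h1, h2⟩ | h'
        · exact Or.inl ⟨β', h1.trans (List.suffix_cons _ _), h2⟩
        · exact Or.inr h'
      · exact Or.inr h'
    · exact Or.inl ⟨b :: β, List.suffix_refl _, (starProd_cons _ _ _).symm⟩
    · exact Or.inr h'

theorem even_length_nrep_seqE (τ : List ℕ) (h : τ ≠ []) (m : ℕ) :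
    Even (nrep (seqE τ) m).length := by
  simp only [nrep, List.length_flatten, List.map_replicate, List.sum_replicate, smul_eq_mul]
  exact (even_length_seqE τ h).mul_left m

theorem seqE_append_lexLt_starProd (τ x β : List ℕ) (h : τ ≠ []) :
    lexLt (seqE τ ++ x) (starProd τ β) := by
  rcases β with _ | ⟨b, β⟩
  · rw [starProd_nil]; exact seqE_append_lexLt τ x h
  · rw [starProd_cons]; exact belowO_seqE_append τ x h _

theorem not_lexLt_nil (s : List ℕ) (hs : ∀ x ∈ s, 0 < x) : ¬ lexLt s [] := by
  rcases s with _ | ⟨a, s⟩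
  · rintro ⟨j, -, hj⟩; exact lt_irrefl _ hj
  · rw [lexLt_iff]
    rintro ⟨j, hag, hj⟩
    have ha : 0 < a := hs a (by simp)
    rcases j with _ | j
    · simp at hj
    · have := hag 0 (by omega)
      simp at this
      omega

theorem starProd_lexLt_starProd (τ β γ : List ℕ) (h : τ ≠ []) (hβ : ∀ x ∈ β, 0 < x)
    (hγ : ∀ x ∈ γ, 0 < x) (hlt : lexLt β γ) : lexLt (starProd τ β) (starProd τ γ) := by
  induction hn : β.length + γ.length using Nat.strong_induction_on generalizing β γ with
  | _ n ih =>
    rcases γ with _ | ⟨c, γ⟩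
    · exact absurd hlt (not_lexLt_nil β hβ)
    rcases β with _ | ⟨b, β⟩
    · rw [starProd_nil, starProd_cons]
      exact belowO_self τ h _
    rw [starProd_cons, starProd_cons]
    refine lexLt_append_odd _ _ _ (odd_length_seqO τ h) ?_
    have hb : 0 < b := hβ b (by simp)
    rcases (lexLt_cons _ _ _ _).mp hlt with hbc | ⟨rfl, hlt'⟩
    · obtain ⟨d, rfl⟩ : ∃ d, c = b + d + 1 := ⟨c - b - 1, by omega⟩
      have e : nrep (seqE τ) (b + d + 1 - 1) =
          nrep (seqE τ) (b - 1) ++ (seqE τ ++ nrep (seqE τ) d) := by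
        rw [show b + d + 1 - 1 = (b - 1) + (1 + d) by omega]
        simp only [nrep, List.replicate_add, List.flatten_append]
        simp
      rw [e, List.append_assoc]
      refine lexLt_append_even _ _ _ (even_length_nrep_seqE τ h _) ?_
      rw [List.append_assoc]
      exact seqE_append_lexLt_starProd τ _ β h
    · refine lexLt_append_even _ _ _ (even_length_nrep_seqE τ h _) ?_
      refine ih (γ.length + β.length) ?_ γ β (fun x hx => hγ x (by simp [hx]))
        (fun x hx => hβ x (by simp [hx])) hlt' rfl
      simp at hn; omega

theorem pos_of_mem_block {τ u : List ℕ} (h : ∀ x ∈ τ, 0 < x)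
    (hu : u = bumpLast τ ∨ u = τ ++ [1]) : ∀ x ∈ u, 0 < x := by
  intro x hx
  rcases hu with rfl | rfl
  · rcases List.mem_append.mp hx with hx | hx
    · exact h x (List.mem_of_mem_dropLast hx)
    · rw [List.mem_singleton.mp hx]; omega
  · rcases List.mem_append.mp hx with hx | hx
    · exact h x hx
    · rw [List.mem_singleton.mp hx]; omega

theorem IsAlphaSeq.starProd {τ : List ℕ} (h : IsAlphaSeq τ) (β : List ℕ) :
    IsAlphaSeq (starProd τ β) := by
  refine ⟨by simp [_root_.starProd, h.1], ?_⟩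
  induction β with
  | nil => rw [starProd_nil]; exact h.2
  | cons b β ih =>
    intro x hx
    rw [starProd_cons] at hx
    rcases List.mem_append.mp hx with hx | hx
    · exact pos_of_mem_block h.2 (seqO_eq τ) x hx
    rcases List.mem_append.mp hx with hx | hx
    · obtain ⟨l, hl, hx⟩ := List.mem_flatten.mp hx
      rw [List.eq_of_mem_replicate hl] at hx
      exact pos_of_mem_block h.2 (seqE_eq τ) x hx
    · exact ih x hx

/-- The star product of lexical sequences is lexical. -/
theorem IsLexical.starProd {τ β : List ℕ} (h : IsLexical τ) (hβ : IsLexical β) :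
    IsLexical (starProd τ β) := by
  refine ⟨h.1.starProd β, fun i hi hil => ?_⟩
  have hne : (_root_.starProd τ β).drop (i - 1) ≠ [] := by
    simp only [ne_eq, List.drop_eq_nil_iff]; omega
  rcases suffix_starProd τ β _ h hne (List.drop_suffix _ _) with ⟨β', hsuf, heq⟩ | hb
  · rw [heq]
    have hβne : β' ≠ β := by
      rintro rfl
      have := congrArg List.length heq
      simp at this
      omega
    refine starProd_lexLt_starProd τ β' β h.1.1 (fun x hx => hβ.1.2 x (hsuf.subset hx)) hβ.1.2 ?_
    by_cases hnil : β' = []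
    · subst hnil
      obtain ⟨b, γ, rfl⟩ := List.exists_cons_of_ne_nil hβ.1.1
      rw [lexLt_iff]
      exact ⟨0, by simp, Or.inl ⟨by simp, by simpa using hβ.1.2 b (by simp)⟩⟩
    · exact hβ.lexLt_of_suffix hsuf hnil hβne
  · obtain ⟨b, γ, rfl⟩ := List.exists_cons_of_ne_nil hβ.1.1
    rw [starProd_cons] at hb ⊢
    exact hb _

theorem isLexical_three_one_one : IsLexical [3, 1, 1] := by
  refine ⟨⟨by simp, by simp⟩, fun i hi hil => ?_⟩
  simp only [List.length_cons, List.length_nil] at hil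
  interval_cases i <;> simp [lexLt_cons]

theorem lexLt_replicate_one (n m : ℕ) (hn : Odd n) (hnm : n < m) (x : List ℕ) :
    lexLt (List.replicate n 1 ++ 2 :: x) (List.replicate m 1) := by
  obtain ⟨d, rfl⟩ : ∃ d, m = n + (d + 1) := ⟨m - n - 1, by omega⟩
  rw [List.replicate_add]
  refine lexLt_append_odd _ _ _ (by simpa using hn) ?_
  simp [List.replicate_succ, lexLt_cons]

theorem isLexical_two_ones_two_ones (n m : ℕ) (hn : Odd n) (hnm : n < m) :
    IsLexical (2 :: (List.replicate n 1 ++ 2 :: List.replicate m 1)) := by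
  refine ⟨⟨by simp, ?_⟩, fun i hi hil => ?_⟩
  · intro x hx
    simp only [List.mem_cons, List.mem_append, List.mem_replicate] at hx
    omega
  obtain ⟨d, rfl⟩ : ∃ d, i = d + 2 := ⟨i - 2, by omega⟩
  rw [show d + 2 - 1 = d + 1 by omega, List.drop_succ_cons]
  simp at hil
  have hones : ∀ e x, 0 < e → lexLt (List.replicate e 1 ++ x)
      (2 :: (List.replicate n 1 ++ 2 :: List.replicate m 1)) := by
    intro e x he
    obtain ⟨e, rfl⟩ : ∃ e', e = e' + 1 := ⟨e - 1, by omega⟩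
    simp [List.replicate_succ, lexLt_cons]
  rw [List.drop_append, List.drop_replicate, List.length_replicate]
  rcases lt_trichotomy d n with hd | rfl | hd
  · exact hones _ _ (by omega)
  · simp only [Nat.sub_self, List.replicate_zero, List.nil_append, List.drop_zero, lexLt_cons]
    exact Or.inr ⟨trivial, lexLt_replicate_one _ _ hn hnm _⟩
  · obtain ⟨e, rfl⟩ : ∃ e, d = n + e + 1 := ⟨d - n - 1, by omega⟩
    rw [show n + e + 1 - n = e + 1 by omega, show n - (n + e + 1) = 0 by omega,
      List.drop_succ_cons, List.drop_replicate]
    have := hones (m - e) [] (by omega)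
    simpa using this

theorem bumpLast_append (x τ : List ℕ) (h : τ ≠ []) : bumpLast (x ++ τ) = x ++ bumpLast τ := by
  obtain ⟨T, a, rfl⟩ := List.eq_nil_or_concat' τ |>.resolve_left h
  rw [← List.append_assoc, bumpLast_append_singleton, bumpLast_append_singleton,
    List.append_assoc]

theorem seqO_append_of_odd (x τ : List ℕ) (h : τ ≠ []) (hx : Odd x.length) :
    seqO (x ++ τ) = x ++ seqE τ := by
  unfold seqO seqE
  rw [List.length_append, bumpLast_append x τ h]
  rcases Nat.even_or_odd τ.length with hτ | hτ
  · rw [if_neg (by grind), if_pos hτ]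
  · rw [if_pos (by grind), if_neg (by grind), List.append_assoc]

/-- Incrementing the last entry of an odd-length `β` in `τ ⋆ β` inserts a block `τ_e`. -/
theorem seqO_starProd_append (τ β : List ℕ) (b : ℕ) (γ : List ℕ) (h : τ ≠ [])
    (hβ : Even β.length) (hb : 0 < b) :
    seqO (starProd τ (β ++ [b])) ++ starProd τ γ = starProd τ (β ++ (b + 1) :: γ) := by
  have hodd : ∀ β : List ℕ, Even ((β.map (fun b =>
      seqO τ ++ nrep (seqE τ) (b - 1))).flatten.length + β.length) := by
    intro β
    induction β with
    | nil => simp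
    | cons c β ih =>
      have h1 := odd_length_seqO τ h
      have h2 := even_length_nrep_seqE τ h (c - 1)
      simp only [List.map_cons, List.flatten_cons, List.length_append, List.length_cons]
      grind
  have e : nrep (seqE τ) (b + 1 - 1) = nrep (seqE τ) (b - 1) ++ seqE τ := by
    obtain ⟨c, rfl⟩ : ∃ c, b = c + 1 := ⟨b - 1, by omega⟩
    simp [nrep, List.replicate_succ']
  have h1 := hodd (β ++ [b])
  unfold starProd
  rw [seqO_append_of_odd _ _ h]
  · simp only [List.map_append, List.map_cons, List.map_nil, List.flatten_append,
      List.flatten_cons, List.flatten_nil, List.append_nil, e, List.append_assoc]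
  · simp only [List.length_append, List.length_singleton] at h1 ⊢
    grind

/-- for `g = τ ⋆ (2,1^{r-3})` and `ĝ = τ ⋆ (1^{r-1})` with `τ`
lexical and `r ≥ 3` odd, `g_o ĝ` equals `τ ⋆ (3,1,1)` (for `r = 3`) or
`τ ⋆ (2,1^{r-4},2,1^{r-1})` (for `r ≥ 5`); in particular `g_o ĝ` is lexical. -/
theorem stmt_9 (τ : List ℕ) (hτ : IsLexical τ) (r : ℕ) (hr : 3 ≤ r) (hodd : Odd r)
    (g ghat : List ℕ)
    (hg : g = starProd τ (2 :: List.replicate (r - 3) 1))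
    (hghat : ghat = starProd τ (List.replicate (r - 1) 1)) :
    (r = 3 → seqO g ++ ghat = starProd τ [3, 1, 1]) ∧
    (5 ≤ r → seqO g ++ ghat =
      starProd τ (2 :: (List.replicate (r - 4) 1 ++ 2 :: List.replicate (r - 1) 1))) ∧
    IsLexical (seqO g ++ ghat) := by
  subst hg hghat
  have h3 : r = 3 → seqO (starProd τ (2 :: List.replicate (r - 3) 1)) ++
      starProd τ (List.replicate (r - 1) 1) = starProd τ [3, 1, 1] := by
    rintro rfl
    exact seqO_starProd_append τ [] 2 [1, 1] hτ.1.1 (by simp) (by omega)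
  have h5 : 5 ≤ r → seqO (starProd τ (2 :: List.replicate (r - 3) 1)) ++
      starProd τ (List.replicate (r - 1) 1) =
      starProd τ (2 :: (List.replicate (r - 4) 1 ++ 2 :: List.replicate (r - 1) 1)) := by
    intro hr5
    have e : 2 :: List.replicate (r - 3) 1 = (2 :: List.replicate (r - 4) 1) ++ [1] := by
      rw [show r - 3 = r - 4 + 1 by omega, List.replicate_succ', List.cons_append]
    rw [e]
    refine seqO_starProd_append τ _ 1 _ hτ.1.1 ?_ (by omega)
    simp only [List.length_cons, List.length_replicate]
    grind
  refine ⟨h3, h5, ?_⟩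
  by_cases hr3 : r = 3
  · rw [h3 hr3]
    exact hτ.starProd isLexical_three_one_one
  · have hr5 : 5 ≤ r := by grind
    rw [h5 hr5]
    exact hτ.starProd (isLexical_two_ones_two_ones _ _ (by grind) (by omega))
end
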